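/- Among all graphs of order n whose adjacency matrix has rank r, the Turán graph T(n,r) is the unique graph attaining the maximum spectral radius. -/

import Mathlib

attribute [local instance] Classical.propDecidable

/-- The spectral radius (largest eigenvalue) of a real symmetric matrix,
as the supremum of its real spectrum. -/
noncomputable def specRad {V : Type*} [Fintype V] [DecidableEq V] (A : Matrix V V ℝ) : ℝ :=
  sSup (spectrum ℝ A)

open Finset
open scoped Matrix

lemma specRad_psd {V : Type*} [Fintype V] [DecidableEq V] (A : Matrix V V ℝ) (hA : A.IsHermitian) :
    (specRad A • (1 : Matrix V V ℝ) - A).PosSemidef := by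
  have hfin : (spectrum ℝ A).Finite := by
    rw [hA.spectrum_real_eq_range_eigenvalues]; exact Set.finite_range _
  rw [Matrix.posSemidef_iff_isHermitian_and_spectrum_nonneg]
  refine ⟨?_, ?_⟩
  · refine Matrix.IsHermitian.sub ?_ hA
    ext i j
    by_cases h : i = j <;> simp [h, eq_comm]
  · intro t ht
    rw [← Algebra.algebraMap_eq_smul_one, ← spectrum.singleton_sub_eq] at ht
    obtain ⟨a, ha, b, hb, rfl⟩ := Set.mem_sub.1 ht
    rw [Set.mem_singleton_iff] at ha
    subst ha
    have := le_csSup hfin.bddAbove hb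
    simpa [specRad] using this

lemma specRad_rayleigh {V : Type*} [Fintype V] [DecidableEq V] (A : Matrix V V ℝ)
    (hA : A.IsHermitian) (x : V → ℝ) : x ⬝ᵥ A *ᵥ x ≤ specRad A * (x ⬝ᵥ x) := by
  have := (specRad_psd A hA).dotProduct_mulVec_nonneg x
  simp only [star_trivial, Matrix.sub_mulVec, Matrix.smul_mulVec, Matrix.one_mulVec,
    dotProduct_sub, dotProduct_smul, smul_eq_mul] at this
  linarith

lemma specRad_rayleigh_eq {V : Type*} [Fintype V] [DecidableEq V] (A : Matrix V V ℝ)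
    (hA : A.IsHermitian) (x : V → ℝ) (h : x ⬝ᵥ A *ᵥ x = specRad A * (x ⬝ᵥ x)) :
    A *ᵥ x = specRad A • x := by
  have := ((specRad_psd A hA).dotProduct_mulVec_zero_iff x).1 (by
    simp only [star_trivial, Matrix.sub_mulVec, Matrix.smul_mulVec, Matrix.one_mulVec,
      dotProduct_sub, dotProduct_smul, smul_eq_mul]
    linarith)
  simp only [Matrix.sub_mulVec, Matrix.smul_mulVec, Matrix.one_mulVec] at this
  exact (sub_eq_zero.1 this).symm

lemma specRad_eigen {V : Type*} [Fintype V] [DecidableEq V] [Nonempty V] (A : Matrix V V ℝ)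
    (hA : A.IsHermitian) : ∃ x : V → ℝ, x ≠ 0 ∧ A *ᵥ x = specRad A • x := by
  have hfin : (spectrum ℝ A).Finite := by
    rw [hA.spectrum_real_eq_range_eigenvalues]; exact Set.finite_range _
  have hne : (spectrum ℝ A).Nonempty := by
    rw [hA.spectrum_real_eq_range_eigenvalues]; exact Set.range_nonempty _
  have hm : specRad A ∈ spectrum ℝ A := hne.csSup_mem hfin
  rw [← Matrix.spectrum_toLin', ← Module.End.hasEigenvalue_iff_mem_spectrum] at hm
  obtain ⟨x, hx⟩ := hm.exists_hasEigenvector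
  exact ⟨x, hx.2, by simpa using hx.apply_eq_smul⟩

/-- The adjacency matrix of the complete multipartite graph with colour classes of `c`. -/
noncomputable def mpMat {n r : ℕ} (c : Fin n → Fin r) : Matrix (Fin n) (Fin n) ℝ :=
  Matrix.of fun u w => if c u ≠ c w then 1 else 0

/-- Size of a colour class. -/
def cls {n r : ℕ} (c : Fin n → Fin r) (i : Fin r) : ℕ := #{v | c v = i}

lemma mpMat_herm {n r : ℕ} (c : Fin n → Fin r) : (mpMat c).IsHermitian := by
  ext i j
  simp [mpMat, eq_comm]

lemma mpMat_mulVec {n r : ℕ} (c : Fin n → Fin r) (x : Fin n → ℝ) (v : Fin n) :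
    (mpMat c *ᵥ x) v = ∑ w with c v ≠ c w, x w := by
  simp [mpMat, Matrix.mulVec, dotProduct, Finset.sum_filter]

lemma sum_cls {n r : ℕ} (c : Fin n → Fin r) : ∑ i, cls c i = n := by
  have := Finset.card_eq_sum_card_fiberwise (s := (univ : Finset (Fin n))) (t := univ) (f := c)
    (by simp)
  simpa [cls] using this.symm

lemma mp_eigen {n r : ℕ} (c : Fin n → Fin r) (x : Fin n → ℝ) (ρ : ℝ) (hρ : 0 < ρ) (hx : x ≠ 0)
    (h : mpMat c *ᵥ x = ρ • x) :
    ∑ i, (cls c i : ℝ) / (ρ + cls c i) = 1 ∧ ∀ v, x v * (ρ + cls c (c v)) = ∑ w, x w := by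
  set S := ∑ w, x w with hS
  set s : Fin r → ℝ := fun i => ∑ w with c w = i, x w with hs
  have h1 : ∀ v, ρ * x v = S - s (c v) := by
    intro v
    have := congrFun h v
    rw [mpMat_mulVec] at this
    simp only [Pi.smul_apply, smul_eq_mul] at this
    have h2 := Finset.sum_filter_add_sum_filter_not univ (fun w => c w = c v) x
    have h3 : ∑ w with c v ≠ c w, x w = ∑ w with ¬ c w = c v, x w := by
      refine Finset.sum_congr (Finset.filter_congr fun w _ => ?_) fun _ _ => rfl
      simp [eq_comm]
    simp only [hs, hS]
    linarith
  have h2 : ∀ i, s i * (ρ + cls c i) = cls c i * S := by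
    intro i
    have : ∑ w with c w = i, ρ * x w = ∑ w with c w = i, (S - s i) := by
      refine Finset.sum_congr rfl fun w hw => ?_
      rw [h1, (Finset.mem_filter.1 hw).2]
    rw [← Finset.mul_sum, Finset.sum_const, nsmul_eq_mul] at this
    change ρ * s i = (cls c i : ℝ) * _ at this
    linarith
  have hpos : ∀ i, 0 < ρ + cls c i := fun i => by positivity
  have h3 : ∀ v, x v * (ρ + cls c (c v)) = S := by
    intro v
    have e1 := h1 v
    have e2 := h2 (c v)
    have : ρ * (x v * (ρ + cls c (c v))) = ρ * S := by
      linear_combination (ρ + cls c (c v)) * e1 - e2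
    exact mul_left_cancel₀ hρ.ne' this
  refine ⟨?_, h3⟩
  have hS0 : S ≠ 0 := by
    intro h0
    apply hx
    ext v
    have := h3 v
    rw [h0] at this
    simpa [(hpos (c v)).ne'] using this
  have h4 : ∑ i, s i = S := by
    simp only [hs, hS]
    exact Finset.sum_fiberwise_of_maps_to (by simp) _
  have h5 : ∑ i, (cls c i : ℝ) / (ρ + cls c i) * S = S := by
    conv_rhs => rw [← h4]
    refine Finset.sum_congr rfl fun i _ => ?_
    rw [div_mul_eq_mul_div, ← h2, mul_div_cancel_right₀ _ (hpos i).ne']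
  rw [← Finset.sum_mul] at h5
  exact mul_right_cancel₀ hS0 (by rw [h5, one_mul])

/-- The chord inequality for `k / (ρ + k)`. -/
lemma chord (ρ : ℝ) (hρ : 0 < ρ) (q k : ℕ) :
    (k : ℝ) / (ρ + k) = q / (ρ + q) + (k - q) * (ρ / ((ρ + q) * (ρ + q + 1)))
      - ((k : ℝ) - q) * (k - q - 1) * (ρ / ((ρ + q) * (ρ + q + 1) * (ρ + k))) := by
  have h1 : 0 < ρ + (q : ℝ) := by positivity
  have h2 : 0 < ρ + (q : ℝ) + 1 := by positivity
  have h3 : 0 < ρ + (k : ℝ) := by positivity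
  field_simp
  ring

lemma chord_nonneg (q k : ℕ) : 0 ≤ ((k : ℝ) - q) * (k - q - 1) := by
  rcases le_or_gt k q with h | h
  · have : (k : ℝ) ≤ q := by exact_mod_cast h
    nlinarith
  · have : (q : ℝ) + 1 ≤ k := by exact_mod_cast h
    nlinarith

lemma chord_sum {n r : ℕ} (c : Fin n → Fin r) (ρ : ℝ) (hρ : 0 < ρ) (q : ℕ) :
    ∑ i, (cls c i : ℝ) / (ρ + cls c i) =
      r * (q / (ρ + q)) + (n - r * q) * (ρ / ((ρ + q) * (ρ + q + 1)))
      - ∑ i, ((cls c i : ℝ) - q) * (cls c i - q - 1) *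
          (ρ / ((ρ + q) * (ρ + q + 1) * (ρ + cls c i))) := by
  rw [Finset.sum_congr rfl fun i _ => chord ρ hρ q (cls c i)]
  rw [Finset.sum_sub_distrib, Finset.sum_add_distrib, ← Finset.sum_mul, Finset.sum_sub_distrib]
  have : ∑ i, (cls c i : ℝ) = n := by exact_mod_cast sum_cls c
  rw [this]
  simp

lemma sum_le_balanced {n r : ℕ} (c d : Fin n → Fin r) (ρ : ℝ) (hρ : 0 < ρ) (q : ℕ)
    (hd : ∀ i, cls d i = q ∨ cls d i = q + 1) :
    ∑ i, (cls c i : ℝ) / (ρ + cls c i) ≤ ∑ i, (cls d i : ℝ) / (ρ + cls d i) ∧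
    (∑ i, (cls c i : ℝ) / (ρ + cls c i) = ∑ i, (cls d i : ℝ) / (ρ + cls d i) →
      ∀ i, cls c i = q ∨ cls c i = q + 1) := by
  rw [chord_sum c ρ hρ q, chord_sum d ρ hρ q]
  have h0 : ∑ i, ((cls d i : ℝ) - q) * (cls d i - q - 1) *
          (ρ / ((ρ + q) * (ρ + q + 1) * (ρ + cls d i))) = 0 := by
    refine Finset.sum_eq_zero fun i _ => ?_
    rcases hd i with h | h <;> simp [h]
  have hnn : ∀ i ∈ (univ : Finset (Fin r)), 0 ≤ ((cls c i : ℝ) - q) * (cls c i - q - 1) *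
          (ρ / ((ρ + q) * (ρ + q + 1) * (ρ + cls c i))) := fun i _ =>
    mul_nonneg (chord_nonneg _ _) (by positivity)
  rw [h0]
  refine ⟨by linarith [Finset.sum_nonneg hnn], fun h i => ?_⟩
  have := (Finset.sum_eq_zero_iff_of_nonneg hnn).1 (by linarith) i (mem_univ i)
  have hp : ρ / ((ρ + q) * (ρ + q + 1) * (ρ + cls c i)) ≠ 0 := by positivity
  rcases mul_eq_zero.1 this with h | h
  · rcases mul_eq_zero.1 h with h | h
    · left; exact_mod_cast sub_eq_zero.1 h
    · right
      have : (cls c i : ℝ) = q + 1 := by linarith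
      exact_mod_cast this
  · exact absurd h hp

lemma sum_sq_balanced {n r : ℕ} (d : Fin n → Fin r) (q : ℕ)
    (hd : ∀ i, cls d i = q ∨ cls d i = q + 1) :
    ∑ i, (cls d i : ℤ) ^ 2 = r * q ^ 2 + (n - r * q) * (2 * q + 1) := by
  have : ∀ i ∈ (univ : Finset (Fin r)), (cls d i : ℤ) ^ 2 =
      q ^ 2 + ((cls d i : ℤ) - q) * (2 * q + 1) := by
    intro i _
    rcases hd i with h | h <;> rw [h] <;> push_cast <;> ring
  rw [Finset.sum_congr rfl this, Finset.sum_add_distrib, ← Finset.sum_mul, Finset.sum_sub_distrib]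
  have : ∑ i, (cls d i : ℤ) = n := by exact_mod_cast sum_cls d
  rw [this]
  simp

lemma edges_mp {n r : ℕ} (G : SimpleGraph (Fin n)) [DecidableRel G.Adj] (c : Fin n → Fin r)
    (h : ∀ u w, G.Adj u w ↔ c u ≠ c w) :
    2 * (#G.edgeFinset : ℤ) = n ^ 2 - ∑ i, (cls c i : ℤ) ^ 2 := by
  have h1 := G.sum_degrees_eq_twice_card_edges
  have h2 : ∀ v, (G.degree v : ℤ) = n - cls c (c v) := by
    intro v
    have e : G.neighborFinset v = univ.filter (fun w => ¬ c w = c v) := by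
      ext w
      simp [h, eq_comm]
    have := Finset.card_filter_add_card_filter_not (s := (univ : Finset (Fin n))) (fun w => c w = c v)
    rw [← SimpleGraph.card_neighborFinset_eq_degree, e]
    simp only [card_univ, Fintype.card_fin] at this
    unfold cls
    omega
  have h3 : ∑ v, (cls c (c v) : ℤ) = ∑ i, (cls c i : ℤ) ^ 2 := by
    rw [← Finset.sum_fiberwise_of_maps_to (s := univ) (t := univ) (g := c) (by simp)]
    refine Finset.sum_congr rfl fun i _ => ?_
    rw [Finset.sum_congr rfl (g := fun _ => (cls c i : ℤ)) (fun v hv => by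
      rw [(Finset.mem_filter.1 hv).2]), Finset.sum_const, nsmul_eq_mul, sq]
    rfl
  have h4 : ((∑ v, G.degree v : ℕ) : ℤ) = 2 * #G.edgeFinset := by rw [h1]; push_cast; rfl
  rw [← h4, ← h3]
  push_cast
  rw [Finset.sum_congr rfl fun v _ => h2 v, Finset.sum_sub_distrib]
  simp [sq]

/-- The colouring of the Turan graph. -/
def tcol (n r : ℕ) (hr : 1 ≤ r) : Fin n → Fin r := fun v => ⟨v % r, Nat.mod_lt _ hr⟩

lemma tcol_cls (n r : ℕ) (hr : 1 ≤ r) (i : Fin r) :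
    cls (tcol n r hr) i = n / r ∨ cls (tcol n r hr) i = n / r + 1 := by
  have h := Nat.count_modEq_card n hr i
  have : cls (tcol n r hr) i = n.count (· ≡ i [MOD r]) := by
    rw [Nat.count_eq_card_filter_range, cls]
    refine Finset.card_bij (fun v _ => (v : ℕ)) ?_ ?_ ?_
    · intro v hv
      have := congrArg Fin.val (Finset.mem_filter.1 hv).2
      simp only [tcol] at this
      simp [Nat.ModEq, this, Nat.mod_eq_of_lt i.2]
    · intro a _ b _ h; exact Fin.ext h
    · intro b hb
      simp only [Finset.mem_filter, Finset.mem_range, Nat.ModEq, Nat.mod_eq_of_lt i.2] at hb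
      exact ⟨⟨b, hb.1⟩, by simp [tcol, Fin.ext_iff, hb.2], rfl⟩
  rw [this, h]
  split_ifs <;> simp

lemma turan_adj (n r : ℕ) (hr : 1 ≤ r) (u w : Fin n) :
    (SimpleGraph.turanGraph n r).Adj u w ↔ tcol n r hr u ≠ tcol n r hr w := by
  simp [SimpleGraph.turanGraph_adj, tcol]

lemma rank_cliqueFree {n r : ℕ} (hr : 1 ≤ r) (G : SimpleGraph (Fin n)) [DecidableRel G.Adj]
    (h : (G.adjMatrix ℝ).rank = r) : G.CliqueFree (r + 1) := by
  by_contra hcl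
  let f := SimpleGraph.topEmbeddingOfNotCliqueFree hcl
  have hle := Matrix.rank_submatrix_le (G.adjMatrix ℝ) f f
  have happ : ∀ i j, (G.adjMatrix ℝ).submatrix f f i j = if i = j then 0 else 1 := by
    intro i j
    by_cases hij : i = j <;> simp [hij]
  have hdet : ((G.adjMatrix ℝ).submatrix f f).det ≠ 0 := by
    intro h0
    obtain ⟨y, hy, hy0⟩ := Matrix.exists_mulVec_eq_zero_iff.2 h0
    have h1 : ∀ i, y i = ∑ j, y j := by
      intro i
      have := congrFun hy0 i
      simp only [Matrix.mulVec, dotProduct, happ, Pi.zero_apply, ite_mul, zero_mul, one_mul] at this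
      have h2 : ∀ j, (if i = j then 0 else y j) = y j - if i = j then y j else 0 := by
        intro j; split_ifs <;> simp
      rw [Finset.sum_congr rfl fun j _ => h2 j, Finset.sum_sub_distrib] at this
      simp at this
      linarith
    have h3 : ∑ j, y j = (r + 1) * ∑ j, y j := by
      conv_lhs => rw [Finset.sum_congr rfl fun j _ => h1 j]
      simp
    have hr0 : (r : ℝ) ≠ 0 := by positivity
    have h4 : ∑ j, y j = 0 := by
      have : (r : ℝ) * ∑ j, y j = 0 := by linarith
      exact (mul_eq_zero.1 this).resolve_left hr0
    exact hy (by ext i; rw [h1 i, h4]; rfl)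
  have := Matrix.rank_of_isUnit _ ((Matrix.isUnit_iff_isUnit_det _).2 hdet.isUnit)
  rw [this, h] at hle
  simp at hle

lemma erdos_weight {V : Type*} [Fintype V] (G : SimpleGraph V) (x : V → ℝ) (hx : ∀ v, 0 ≤ x v) (r : ℕ) :
    ∀ S : Finset V, (∀ t ⊆ S, ¬ G.IsNClique (r+1) t) →
    ∃ c : V → ℕ, (∀ v ∈ S, c v < r) ∧
      (∀ u ∈ S, ∑ w ∈ S with G.Adj u w, x w ≤ ∑ w ∈ S with c u ≠ c w, x w) ∧
      ((∀ v, 0 < x v) → (∀ u ∈ S, ∑ w ∈ S with G.Adj u w, x w = ∑ w ∈ S with c u ≠ c w, x w) →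
        ∀ u ∈ S, ∀ w ∈ S, G.Adj u w ↔ c u ≠ c w) := by
  induction r with
  | zero =>
    intro S hS
    have : S = ∅ := by
      by_contra h
      obtain ⟨v, hv⟩ := Finset.nonempty_iff_ne_empty.2 h
      exact hS {v} (by simpa using hv) (by simp [SimpleGraph.isNClique_iff])
    subst this
    exact ⟨fun _ => 0, by simp⟩
  | succ r ih =>
    intro S hS
    rcases S.eq_empty_or_nonempty with rfl | hne
    · exact ⟨fun _ => 0, by simp⟩
    obtain ⟨v, hvS, hv⟩ := S.exists_max_image (fun u => ∑ w ∈ S with G.Adj u w, x w) hne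
    set S' := S.filter (G.Adj v) with hS'
    obtain ⟨c', hc1, hc2, hc3⟩ := ih S' (by
      intro t ht hcl
      refine hS (insert v t) ?_ (hcl.insert ?_)
      · intro a ha
        rcases Finset.mem_insert.1 ha with rfl | h
        · exact hvS
        · exact (Finset.mem_filter.1 (ht h)).1
      · intro b hb
        exact (Finset.mem_filter.1 (ht hb)).2)
    set c : V → ℕ := fun w => if w ∈ S' then c' w else r with hc
    have hsub : S' ⊆ S := Finset.filter_subset _ _
    have cin : ∀ w ∈ S', c w = c' w := fun w hw => by simp [hc, hw]
    have cout : ∀ w ∉ S', c w = r := fun w hw => by simp [hc, hw]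
    -- splitting of sums
    have split : ∀ (p : V → Prop) [DecidablePred p], ∑ w ∈ S with p w, x w =
        ∑ w ∈ S' with p w, x w + ∑ w ∈ S \ S' with p w, x w := by
      intro p _
      rw [Finset.sum_filter p, Finset.sum_filter p, Finset.sum_filter p, add_comm, Finset.sum_sdiff hsub]
    have houtH : ∀ u ∈ S, u ∉ S' → ∑ w ∈ S with c u ≠ c w, x w = ∑ w ∈ S', x w := by
      intro u hu hu'
      congr 1
      ext w
      simp only [Finset.mem_filter]
      constructor
      · rintro ⟨h1, h2⟩
        by_contra hw
        exact h2 (by rw [cout u hu', cout w hw])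
      · intro hw
        refine ⟨hsub hw, ?_⟩
        rw [cout u hu', cin w hw]
        exact (hc1 w hw).ne'
    have hinH : ∀ u ∈ S', ∑ w ∈ S with c u ≠ c w, x w =
        ∑ w ∈ S' with c' u ≠ c' w, x w + ∑ w ∈ S \ S', x w := by
      intro u hu
      rw [split]
      congr 1
      · refine Finset.sum_congr (Finset.filter_congr fun w hw => ?_) fun _ _ => rfl
        rw [cin u hu, cin w hw]
      · congr 1
        rw [Finset.filter_eq_self]
        intro w hw
        rw [cin u hu, cout w (Finset.mem_sdiff.1 hw).2]
        exact (hc1 u hu).ne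
    have hle : ∀ u, ∑ w ∈ S \ S' with G.Adj u w, x w ≤ ∑ w ∈ S \ S', x w := fun u =>
      Finset.sum_le_sum_of_subset_of_nonneg (Finset.filter_subset _ _) fun _ _ _ => hx _
    refine ⟨c, ?_, ?_, ?_⟩
    · intro w hw
      by_cases h : w ∈ S'
      · rw [cin w h]; exact (hc1 w h).trans (Nat.lt_succ_self r)
      · rw [cout w h]; exact Nat.lt_succ_self r
    · intro u hu
      by_cases h : u ∈ S'
      · rw [hinH u h, split]
        exact add_le_add (hc2 u h) (hle u)
      · rw [houtH u hu h]
        exact hv u hu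
    · intro hpos heq
      have hA : ∀ u ∈ S', ∑ w ∈ S' with G.Adj u w, x w = ∑ w ∈ S' with c' u ≠ c' w, x w ∧
          ∑ w ∈ S \ S' with G.Adj u w, x w = ∑ w ∈ S \ S', x w := by
        intro u hu
        have := heq u (hsub hu)
        rw [hinH u hu, split] at this
        have h1 := hc2 u hu
        have h2 := hle u
        constructor <;> linarith
      have hIH := hc3 hpos fun u hu => (hA u hu).1
      have key : ∀ (A B : Finset V), A ⊆ B → ∑ w ∈ A, x w = ∑ w ∈ B, x w → A = B := by
        intro A B hAB h
        by_contra hne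
        have : A ⊂ B := lt_of_le_of_ne hAB hne
        obtain ⟨b, hb, hb'⟩ := Finset.exists_of_ssubset this
        have := Finset.sum_lt_sum_of_subset hAB hb hb' (hpos b) fun j _ _ => hx j
        linarith
      have hcross : ∀ u ∈ S', ∀ w ∈ S, w ∉ S' → G.Adj u w := by
        intro u hu w hw hw'
        have := key _ _ (Finset.filter_subset _ _) (hA u hu).2
        have hm : w ∈ S \ S' := Finset.mem_sdiff.2 ⟨hw, hw'⟩
        rw [← this] at hm
        exact (Finset.mem_filter.1 hm).2
      intro u hu w hw
      by_cases h : u ∈ S' <;> by_cases h' : w ∈ S'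
      · rw [cin u h, cin w h']; exact hIH u h w h'
      · rw [cin u h, cout w h']
        exact iff_of_true (hcross u h w hw h') (hc1 u h).ne
      · rw [cin w h', cout u h]
        exact iff_of_true (hcross w h' u hu h).symm (hc1 w h').ne'
      · rw [cout u h, cout w h']
        refine iff_of_false ?_ (by simp)
        intro hadj
        have e := heq u hu
        rw [houtH u hu h] at e
        have := key S' (S.filter (G.Adj u)) (fun a ha =>
          Finset.mem_filter.2 ⟨hsub ha, (hcross a ha u hu h).symm⟩) e.symm
        exact h' (by rw [this]; exact Finset.mem_filter.2 ⟨hw, hadj⟩)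

/-- Among all graphs of order `n` with adjacency rank `r`, the Turán graph `T(n,r)` is
the unique graph (up to isomorphism) attaining the maximum spectral radius. -/
theorem stmt_5 (n r : ℕ) (hr : 1 ≤ r) (hrn : r ≤ n) (G : SimpleGraph (Fin n))
    (hrank : (G.adjMatrix ℝ).rank = r) :
    specRad (G.adjMatrix ℝ) ≤ specRad ((SimpleGraph.turanGraph n r).adjMatrix ℝ) ∧
      (specRad (G.adjMatrix ℝ) = specRad ((SimpleGraph.turanGraph n r).adjMatrix ℝ) →
        Nonempty (G ≃g SimpleGraph.turanGraph n r)) := by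
  have hcf := rank_cliqueFree hr G hrank
  have hr2 : 2 ≤ r := by
    by_contra hlt
    have : r = 1 := by omega
    subst this
    have hb : G = ⊥ := SimpleGraph.cliqueFree_two.1 hcf
    have h0 : G.adjMatrix ℝ = 0 := by
      ext i j
      simp [SimpleGraph.adjMatrix_apply, hb]
    rw [h0, Matrix.rank_zero] at hrank
    omega
  have : Nonempty (Fin n) := ⟨⟨0, by omega⟩⟩
  set d := tcol n r hr with hd
  have hT : (SimpleGraph.turanGraph n r).adjMatrix ℝ = mpMat d := by
    ext u w
    simp only [SimpleGraph.adjMatrix_apply, mpMat, Matrix.of_apply, turan_adj n r hr, hd]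
  rw [hT]
  set ρ := specRad (mpMat d) with hρ
  have hball := tcol_cls n r hr
  -- positivity of the spectral radius of the Turan graph
  have hρpos : 0 < ρ := by
    have h1 := specRad_rayleigh (mpMat d) (mpMat_herm d) 1
    have h2 : 0 < (1 : Fin n → ℝ) ⬝ᵥ mpMat d *ᵥ 1 := by
      simp only [dotProduct, mpMat_mulVec, Pi.one_apply, one_mul]
      refine Finset.sum_pos' (fun i _ => Finset.sum_nonneg fun _ _ => zero_le_one)
        ⟨⟨0, by omega⟩, mem_univ _, ?_⟩
      refine Finset.sum_pos (fun _ _ => zero_lt_one) ⟨⟨1, by omega⟩, ?_⟩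
      simp only [Finset.mem_filter, mem_univ, true_and, hd, tcol, ne_eq, Fin.mk.injEq]
      rw [Nat.mod_eq_of_lt (show 1 < r by omega)]
      simp
    have h3 : (1 : Fin n → ℝ) ⬝ᵥ 1 = n := by simp
    rw [h3] at h1
    have hn : (0 : ℝ) < n := by exact_mod_cast (by omega : 0 < n)
    by_contra hneg
    have := mul_nonneg (neg_nonneg.2 (not_lt.1 hneg)) hn.le
    linarith
  obtain ⟨z, hz0, hz⟩ := specRad_eigen (mpMat d) (mpMat_herm d)
  have hsumT := (mp_eigen d z ρ hρpos hz0 hz).1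
  -- the nonnegative test vector
  obtain ⟨y, hy0, hy⟩ := specRad_eigen (G.adjMatrix ℝ) (G.isHermitian_adjMatrix ℝ)
  set x : Fin n → ℝ := fun v => |y v| with hx
  have hxnn : ∀ v, 0 ≤ x v := fun v => abs_nonneg _
  have hx0 : x ≠ 0 := by
    intro h
    apply hy0
    ext v
    simpa [hx] using congrFun h v
  have hxx : x ⬝ᵥ x = y ⬝ᵥ y := by
    simp [dotProduct, hx]
  have hxxpos : 0 < x ⬝ᵥ x := by
    obtain ⟨v, hv⟩ := Function.ne_iff.1 hx0
    refine Finset.sum_pos' (fun i _ => mul_self_nonneg _) ⟨v, mem_univ _, ?_⟩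
    exact mul_self_pos.2 hv
  have hGx : ∀ v, (G.adjMatrix ℝ *ᵥ x) v = ∑ w with G.Adj v w, x w := by
    intro v
    simp [Matrix.mulVec, dotProduct, Finset.sum_filter, SimpleGraph.adjMatrix_apply]
  have hG1 : specRad (G.adjMatrix ℝ) * (x ⬝ᵥ x) ≤ x ⬝ᵥ G.adjMatrix ℝ *ᵥ x := by
    have e : y ⬝ᵥ G.adjMatrix ℝ *ᵥ y = specRad (G.adjMatrix ℝ) * (y ⬝ᵥ y) := by
      rw [hy, dotProduct_smul, smul_eq_mul]
    rw [hxx, ← e]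
    simp only [Matrix.mulVec, dotProduct, Finset.mul_sum]
    refine Finset.sum_le_sum fun i _ => Finset.sum_le_sum fun j _ => ?_
    refine (le_abs_self _).trans ?_
    rw [abs_mul, abs_mul]
    refine mul_le_mul_of_nonneg_left (mul_le_mul_of_nonneg_right ?_ (abs_nonneg _)) (abs_nonneg _)
    rw [SimpleGraph.adjMatrix_apply]
    split_ifs <;> simp
  obtain ⟨c0, hc1, hc2, hc3⟩ := erdos_weight G x hxnn r univ (fun t _ => hcf t)
  let c : Fin n → Fin r := fun v => ⟨c0 v, hc1 v (mem_univ v)⟩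
  have hcc : ∀ u w, c u ≠ c w ↔ c0 u ≠ c0 w := by
    intro u w; simp [c]
  have hHx : ∀ v, (mpMat c *ᵥ x) v = ∑ w with c0 v ≠ c0 w, x w := by
    intro v
    rw [mpMat_mulVec]
    exact Finset.sum_congr (Finset.filter_congr fun w _ => hcc v w) fun _ _ => rfl
  have hle : ∀ v, (G.adjMatrix ℝ *ᵥ x) v ≤ (mpMat c *ᵥ x) v := by
    intro v
    rw [hGx, hHx]
    exact hc2 v (mem_univ v)
  have hGH : x ⬝ᵥ G.adjMatrix ℝ *ᵥ x ≤ x ⬝ᵥ mpMat c *ᵥ x :=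
    Finset.sum_le_sum fun v _ => mul_le_mul_of_nonneg_left (hle v) (hxnn v)
  have hHray := specRad_rayleigh (mpMat c) (mpMat_herm c) x
  have hbal := sum_le_balanced c d ρ hρpos (n / r) hball
  have hHT : specRad (mpMat c) ≤ ρ := by
    by_contra hlt
    push Not at hlt
    obtain ⟨z', hz0', hz'⟩ := specRad_eigen (mpMat c) (mpMat_herm c)
    have e1 := (mp_eigen c z' _ (hρpos.trans hlt) hz0' hz').1
    have e2 : ∑ i, (cls c i : ℝ) / (specRad (mpMat c) + cls c i) <
        ∑ i, (cls c i : ℝ) / (ρ + cls c i) := by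
      refine Finset.sum_lt_sum (fun i _ => ?_) ?_
      · have : 0 < ρ + (cls c i : ℝ) := by positivity
        gcongr
      · have hv : 0 < cls c (c ⟨0, by omega⟩) :=
          Finset.card_pos.2 ⟨⟨0, by omega⟩, by simp⟩
        refine ⟨c ⟨0, by omega⟩, mem_univ _, ?_⟩
        have hv' : (0 : ℝ) < cls c (c ⟨0, by omega⟩) := by exact_mod_cast hv
        have : 0 < ρ + (cls c (c ⟨0, by omega⟩) : ℝ) := by positivity
        gcongr
    have := hbal.1
    linarith
  have hchain := mul_le_mul_of_nonneg_right hHT hxxpos.le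
  refine ⟨le_of_mul_le_mul_right (by linarith) hxxpos, fun heq => ?_⟩
  rw [heq] at hG1
  have hHeq : specRad (mpMat c) = ρ :=
    mul_right_cancel₀ hxxpos.ne' (by linarith)
  have hxH := specRad_rayleigh_eq (mpMat c) (mpMat_herm c) x (by linarith)
  obtain ⟨hs1, hs2⟩ := mp_eigen c x ρ hρpos hx0 (by rw [hxH, hHeq])
  have hcb := hbal.2 (by rw [hs1, hsumT])
  have hSpos : 0 < ∑ w, x w := by
    obtain ⟨v, hv⟩ := Function.ne_iff.1 hx0
    exact Finset.sum_pos' (fun i _ => hxnn i) ⟨v, mem_univ _, lt_of_le_of_ne (hxnn v) (Ne.symm hv)⟩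
  have hxpos : ∀ v, 0 < x v := by
    intro v
    refine lt_of_le_of_ne (hxnn v) fun h0 => ?_
    have := hs2 v
    rw [← h0, zero_mul] at this
    linarith
  have hdeq : ∀ v, (G.adjMatrix ℝ *ᵥ x) v = (mpMat c *ᵥ x) v := by
    have e : ∑ v, x v * (G.adjMatrix ℝ *ᵥ x) v = ∑ v, x v * (mpMat c *ᵥ x) v := by
      change x ⬝ᵥ G.adjMatrix ℝ *ᵥ x = x ⬝ᵥ mpMat c *ᵥ x
      linarith
    have := (Finset.sum_eq_sum_iff_of_le fun v _ =>
      mul_le_mul_of_nonneg_left (hle v) (hxnn v)).1 e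
    intro v
    exact mul_left_cancel₀ (hxpos v).ne' (this v (mem_univ v))
  have hadj : ∀ u w, G.Adj u w ↔ c u ≠ c w := by
    intro u w
    rw [hcc]
    refine hc3 hxpos (fun u _ => ?_) u (mem_univ u) w (mem_univ w)
    rw [← hGx, ← hHx, hdeq]
  have hE1 := edges_mp G c hadj
  have hE2 := edges_mp (SimpleGraph.turanGraph n r) d (turan_adj n r hr)
  rw [sum_sq_balanced c _ hcb] at hE1
  rw [sum_sq_balanced d _ hball] at hE2
  have hE : #G.edgeFinset = #(SimpleGraph.turanGraph n r).edgeFinset := by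
    have : (2 : ℤ) * #G.edgeFinset = 2 * #(SimpleGraph.turanGraph n r).edgeFinset := by
      rw [hE1, hE2]
    omega
  have hmax : G.IsTuranMaximal r := by
    refine ⟨hcf, fun G' _ hG' => ?_⟩
    rw [hE]
    exact (SimpleGraph.isTuranMaximal_turanGraph (n := n) (r := r) hr).2 hG'
  have hiso := hmax.nonempty_iso_turanGraph
  rw [Fintype.card_fin] at hiso
  exact hiso
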